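/- arXiv:0803.1890 — 2 statements merged into one kernel-verified Lean document; each statement's English description precedes it below -/
import Mathlib

section
/- Fix k ∈ ℕ and assume that every X ∈ 𝒳_s cannot revive from bankruptcy. For u ∈ 𝕋^k with u > 0 and i ∈ {1,…,d}, define ΔR^i_u := (S^i_u / S^i_{u−1/2^k} − 1)·1_{{S^i_{u−1/2^k} > 0}}. Then: (a) for every collection π = (π_u)_{u ∈ 𝕋^k, u>0} such that each π_u is ℱ_{u−1/2^k}-measurable and takes values in the simplex Δ^d, there exists X ∈ 𝒳_s^k(1) with X_t = ∏_{u ∈ 𝕋^k, 0 < u ≤ t} (1 + ⟨π_u, ΔR_u⟩) for all t ∈ 𝕋^k; and (b) conversely, for every X ∈ 𝒳_s^k(1) there exists such a collection π with X_t = ∏_{u ∈ 𝕋^k, 0 < u ≤ t} (1 + ⟨π_u, ΔR_u⟩) for all t ∈ 𝕋^k. -/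
open MeasureTheory Set Filter
open scoped NNReal ENNReal Topology

noncomputable section

/-- A property of a path: right-continuous with left limits (càdlàg). -/
def IsCadlag {E : Type*} [TopologicalSpace E] (f : ℝ≥0 → E) : Prop :=
  (∀ t : ℝ≥0, ContinuousWithinAt f (Set.Ici t) t) ∧
    ∀ t : ℝ≥0, 0 < t → ∃ l : E, Filter.Tendsto f (nhdsWithin t (Set.Iio t)) (nhds l)

/-- The `d`-dimensional simplex. -/
def stdSimplexSet (d : ℕ) : Set (Fin d → ℝ) :=
  {z | (∀ i, 0 ≤ z i) ∧ ∑ i, z i ≤ 1}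

variable {Ω : Type*} {m : MeasurableSpace Ω}

/-- A simple predictable strategy: finitely many trading times `τ 0 = 0 ≤ τ 1 ≤ … ≤ τ n`
(finite stopping times), where the (random) vector `ϑ j` of numbers of units of the `d` assets
held on the interval `(τ j, τ (j+1)]` is `ℱ_{τ j}`-measurable. -/
structure SimpleStrategy (ℱ : MeasureTheory.Filtration ℝ≥0 m) (d : ℕ) where
  n : ℕ
  τ : ℕ → Ω → ℝ≥0
  ϑ : ℕ → Ω → Fin d → ℝ
  τ_zero : ∀ ω, τ 0 ω = 0
  τ_mono : ∀ j, ∀ ω, τ j ω ≤ τ (j + 1) ω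
  τ_stopping : ∀ j, MeasureTheory.IsStoppingTime ℱ (fun ω => (τ j ω : WithTop ℝ≥0))
  ϑ_meas : ∀ j, Measurable[(τ_stopping j).measurableSpace] (ϑ j)

namespace SimpleStrategy

variable {ℱ : MeasureTheory.Filtration ℝ≥0 m} {d : ℕ}

/-- The wealth process `X^{x,θ}` associated with initial capital `x` and simple strategy `θ`. -/
def wealth (θ : SimpleStrategy ℱ d) (S : ℝ≥0 → Ω → Fin d → ℝ) (x : ℝ) (t : ℝ≥0) (ω : Ω) : ℝ :=
  x + ∑ j ∈ Finset.range θ.n, ∑ i, θ.ϑ j ω i *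
    (S (min (θ.τ (j + 1) ω) t) ω i - S (min (θ.τ j ω) t) ω i)

/-- No-short-sales admissibility: all holdings are nonnegative, and the value of the held
assets never exceeds current wealth. -/
def Admissible (θ : SimpleStrategy ℱ d) (P : MeasureTheory.Measure Ω)
    (S : ℝ≥0 → Ω → Fin d → ℝ) (x : ℝ) : Prop :=
  ∀ j < θ.n, ∀ᵐ ω ∂P, (∀ i, 0 ≤ θ.ϑ j ω i) ∧
    ∑ i, θ.ϑ j ω i * S (θ.τ j ω) ω i ≤ θ.wealth S x (θ.τ j ω) ω

end SimpleStrategy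

/-- `𝒳_s(x)`: wealth processes of simple, no-short-sales strategies with initial capital `x`. -/
def Xs (P : MeasureTheory.Measure Ω) (ℱ : MeasureTheory.Filtration ℝ≥0 m) {d : ℕ}
    (S : ℝ≥0 → Ω → Fin d → ℝ) (x : ℝ) : Set (ℝ≥0 → Ω → ℝ) :=
  {X | ∃ θ : SimpleStrategy ℱ d, θ.Admissible P S x ∧ X = θ.wealth S x}

/-- `𝒳_s = ⋃_{x ≥ 0} 𝒳_s(x)`. -/
def XsAll (P : MeasureTheory.Measure Ω) (ℱ : MeasureTheory.Filtration ℝ≥0 m) {d : ℕ}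
    (S : ℝ≥0 → Ω → Fin d → ℝ) : Set (ℝ≥0 → Ω → ℝ) :=
  {X | ∃ x : ℝ, 0 ≤ x ∧ X ∈ Xs P ℱ S x}

/-- `ξ` is an arbitrage of the first kind on `[0, T]`. -/
def ArbitrageOfFirstKind (P : MeasureTheory.Measure Ω) (ℱ : MeasureTheory.Filtration ℝ≥0 m)
    {d : ℕ} (S : ℝ≥0 → Ω → Fin d → ℝ) (T : ℝ≥0) (ξ : Ω → ℝ) : Prop :=
  Measurable[ℱ T] ξ ∧ (∀ᵐ ω ∂P, 0 ≤ ξ ω) ∧ 0 < P {ω | 0 < ξ ω} ∧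
    ∀ x : ℝ, 0 < x → ∃ X ∈ Xs P ℱ S x, ∀ᵐ ω ∂P, ξ ω ≤ X T ω

/-- Condition NA1_s: no arbitrage of the first kind on any interval `[0, T]`. -/
def NA1s (P : MeasureTheory.Measure Ω) (ℱ : MeasureTheory.Filtration ℝ≥0 m) {d : ℕ}
    (S : ℝ≥0 → Ω → Fin d → ℝ) : Prop :=
  ∀ (T : ℝ≥0) (ξ : Ω → ℝ), ¬ ArbitrageOfFirstKind P ℱ S T ξ

/-- A set of random variables is bounded in probability. -/
def BddInProb (P : MeasureTheory.Measure Ω) (C : Set (Ω → ℝ)) : Prop :=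
  Filter.Tendsto (fun ℓ : ℝ => ⨆ f ∈ C, P {ω | ℓ < |f ω|}) Filter.atTop (nhds 0)

/-- The filtration is right-continuous. -/
def RightContinuousFiltration (ℱ : MeasureTheory.Filtration ℝ≥0 m) : Prop :=
  ∀ t : ℝ≥0, (ℱ t : MeasurableSpace Ω) = ⨅ (u : ℝ≥0) (_ : t < u), ℱ u

/-- `ℱ 0` (hence every `ℱ t`) contains all `P`-null sets. -/
def CompleteFiltration (ℱ : MeasureTheory.Filtration ℝ≥0 m) (P : MeasureTheory.Measure Ω) : Prop :=
  ∀ N : Set Ω, MeasurableSet N → P N = 0 → MeasurableSet[ℱ 0] N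

/-- The (first) bankruptcy time `ζ^X` of a process `X`, valued in `ℝ≥0∞`. -/
def bankruptcyTime (X : ℝ≥0 → Ω → ℝ) (ω : Ω) : ℝ≥0∞ :=
  sInf ((fun t : ℝ≥0 => (t : ℝ≥0∞)) ''
    {t : ℝ≥0 | Function.leftLim (fun s => X s ω) t = 0 ∨ X t ω = 0})

/-- `X` cannot revive from bankruptcy: a.s., `X_t = 0` for all `t ≥ ζ^X` on `{ζ^X < ∞}`. -/
def CannotRevive (P : MeasureTheory.Measure Ω) (X : ℝ≥0 → Ω → ℝ) : Prop :=
  ∀ᵐ ω ∂P, ∀ t : ℝ≥0, bankruptcyTime X ω ≤ (t : ℝ≥0∞) → X t ω = 0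

/-- `𝒴_s`: strictly positive supermartingale deflators for simple, no-short-sales trading. -/
def Ys (P : MeasureTheory.Measure Ω) (ℱ : MeasureTheory.Filtration ℝ≥0 m) {d : ℕ}
    (S : ℝ≥0 → Ω → Fin d → ℝ) : Set (ℝ≥0 → Ω → ℝ) :=
  {Y | MeasureTheory.StronglyAdapted ℱ Y ∧ (∀ ω, IsCadlag (fun t => Y t ω)) ∧
    (∀ᵐ ω ∂P, Y 0 ω = 1 ∧ ∀ t : ℝ≥0, 0 < Y t ω) ∧
    ∀ X ∈ XsAll P ℱ S, MeasureTheory.Supermartingale (fun t ω => Y t ω * X t ω) ℱ P}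

/-- The dyadic trading-time grid `𝕋^k = {m/2^k : m ∈ ℕ, 0 ≤ m ≤ k·2^k}`. -/
def dyadicGrid (k : ℕ) : Set ℝ≥0 :=
  {t | ∃ m : ℕ, m ≤ k * 2 ^ k ∧ t = (m : ℝ≥0) / 2 ^ k}

/-- `𝒳_s^k(1)`: wealth processes in `𝒳_s(1)` whose trading times all belong to `𝕋^k`. -/
def Xsk {Ω : Type*} {m : MeasurableSpace Ω} (P : MeasureTheory.Measure Ω)
    (ℱ : MeasureTheory.Filtration ℝ≥0 m) {d : ℕ} (S : ℝ≥0 → Ω → Fin d → ℝ) (k : ℕ) :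
    Set (ℝ≥0 → Ω → ℝ) :=
  {X | ∃ θ : SimpleStrategy ℱ d, θ.Admissible P S 1 ∧
    (∀ j ≤ θ.n, ∀ ω, θ.τ j ω ∈ dyadicGrid k) ∧ X = θ.wealth S 1}

/-- The one-period relative return `ΔR^i_u := (S^i_u / S^i_{u−1/2^k} − 1)·1_{S^i_{u−1/2^k} > 0}`
for the `u`-th grid point `u/2^k` of `𝕋^k` (here `u : ℕ`, `u ≥ 1`). -/
def deltaR {Ω : Type*} {d : ℕ} (S : ℝ≥0 → Ω → Fin d → ℝ) (k : ℕ) (u : ℕ) (ω : Ω) (i : Fin d) :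
    ℝ :=
  if 0 < S (((u - 1 : ℕ) : ℝ≥0) / 2 ^ k) ω i then
    S ((u : ℝ≥0) / 2 ^ k) ω i / S (((u - 1 : ℕ) : ℝ≥0) / 2 ^ k) ω i - 1
  else 0

namespace MC

/-- grid point -/
def gt (k u : ℕ) : ℝ≥0 := (u : ℝ≥0) / 2 ^ k

lemma gt_le_iff {k a b : ℕ} : gt k a ≤ gt k b ↔ a ≤ b := by
  unfold gt
  rw [div_le_div_iff_of_pos_right (by positivity)]
  exact Nat.cast_le

lemma gt_mono {k a b : ℕ} (h : a ≤ b) : gt k a ≤ gt k b := gt_le_iff.2 h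

lemma gt_zero (k : ℕ) : gt k 0 = 0 := by simp [gt]

lemma S_meas {ℱ : MeasureTheory.Filtration ℝ≥0 m} {d : ℕ} {S : ℝ≥0 → Ω → Fin d → ℝ}
    (hS : MeasureTheory.StronglyAdapted ℱ S) {s t : ℝ≥0} (hst : s ≤ t) (i : Fin d) :
    Measurable[ℱ t] (fun ω => S s ω i) :=
  ((measurable_pi_apply i).comp (hS s).measurable).mono (ℱ.mono hst) le_rfl

lemma meas_delta {mG : MeasurableSpace Ω} {f g : Ω → ℝ} (hf : Measurable f) (hg : Measurable g) :
    Measurable (fun ω => if 0 < f ω then g ω / f ω - 1 else 0) :=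
  Measurable.ite (measurableSet_lt measurable_const hf) ((hg.div hf).sub_const 1) measurable_const

lemma meas_hold {mG : MeasurableSpace Ω} {f g : Ω → ℝ} (hf : Measurable f) (hg : Measurable g) :
    Measurable (fun ω => if 0 < f ω then g ω / f ω else 0) :=
  Measurable.ite (measurableSet_lt measurable_const hf) (hg.div hf) measurable_const

lemma meas_ind {mG : MeasurableSpace Ω} {f : Ω → ℝ} (hf : Measurable f) (a : ℝ) :
    Measurable (fun ω => if f ω = 0 then a else 0) :=
  Measurable.ite (measurableSet_eq_fun hf measurable_const) measurable_const measurable_const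

lemma meas_prod {mG : MeasurableSpace Ω} {ι : Type*} {s : Finset ι} {f : ι → Ω → ℝ}
    (hf : ∀ u ∈ s, Measurable (f u)) : Measurable (fun ω => ∏ u ∈ s, f u ω) :=
  Finset.measurable_prod s hf

lemma meas_sum {mG : MeasurableSpace Ω} {ι : Type*} {s : Finset ι} {f : ι → Ω → ℝ}
    (hf : ∀ u ∈ s, Measurable (f u)) : Measurable (fun ω => ∑ u ∈ s, f u ω) :=
  Finset.measurable_sum s hf

/-- strategy trading at deterministic grid times -/
def gridStrat (ℱ : MeasureTheory.Filtration ℝ≥0 m) {d : ℕ} (k n : ℕ) (ϑ : ℕ → Ω → Fin d → ℝ)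
    (h : ∀ j, Measurable[ℱ (gt k j)] (ϑ j)) : SimpleStrategy ℱ d where
  n := n
  τ := fun j _ => gt k j
  ϑ := ϑ
  τ_zero := fun _ => gt_zero k
  τ_mono := fun j _ => gt_mono (Nat.le_succ j)
  τ_stopping := fun j => isStoppingTime_const ℱ (gt k j)
  ϑ_meas := fun j => by
    rw [IsStoppingTime.measurableSpace_const]
    exact h j

lemma gridStrat_wealth (ℱ : MeasureTheory.Filtration ℝ≥0 m) {d : ℕ} (k n : ℕ)
    (ϑ : ℕ → Ω → Fin d → ℝ)
    (h : ∀ j, Measurable[ℱ (gt k j)] (ϑ j)) (S : ℝ≥0 → Ω → Fin d → ℝ) (x : ℝ) (M : ℕ)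
    (hM : M ≤ n) (ω : Ω) :
    (gridStrat ℱ k n ϑ h).wealth S x (gt k M) ω =
      x + ∑ j ∈ Finset.range M, ∑ i, ϑ j ω i * (S (gt k (j + 1)) ω i - S (gt k j) ω i) := by
  unfold SimpleStrategy.wealth gridStrat
  simp only
  congr 1
  symm
  apply Finset.sum_subset_zero_on_sdiff (Finset.range_mono hM)
  · intro j hj
    simp only [Finset.mem_sdiff, Finset.mem_range, not_lt] at hj
    rw [min_eq_right (gt_mono (by omega)), min_eq_right (gt_mono (by omega))]
    simp
  · intro j hj
    simp only [Finset.mem_range] at hj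
    rw [min_eq_left (gt_mono (by omega)), min_eq_left (gt_mono (by omega))]

lemma revive {P : MeasureTheory.Measure Ω} {X : ℝ≥0 → Ω → ℝ} (h : CannotRevive P X) :
    ∀ᵐ ω ∂P, ∀ s t : ℝ≥0, s ≤ t → X s ω = 0 → X t ω = 0 := by
  filter_upwards [h] with ω hω s t hst hs
  apply hω
  refine le_trans (sInf_le (Set.mem_image_of_mem _ (Or.inr hs : s ∈ _))) ?_
  exact_mod_cast hst

lemma S_dead {P : MeasureTheory.Measure Ω} {ℱ : MeasureTheory.Filtration ℝ≥0 m}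
    {d : ℕ} {S : ℝ≥0 → Ω → Fin d → ℝ}
    (hS_adapted : MeasureTheory.StronglyAdapted ℱ S)
    (hcr : ∀ X ∈ XsAll P ℱ S, CannotRevive P X) (k j : ℕ) (i : Fin d) :
    ∀ᵐ ω ∂P, S (gt k j) ω i = 0 → S (gt k (j + 1)) ω i = 0 := by
  classical
  let ϑ : ℕ → Ω → Fin d → ℝ := fun l ω i' =>
    if S (gt k l) ω i' = 0 then (if l = j ∧ i' = i then 1 else 0) else 0
  have hϑ : ∀ l, Measurable[ℱ (gt k l)] (ϑ l) := fun l =>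
    @measurable_pi_lambda _ _ _ (ℱ (gt k l)) _ _ fun i' => meas_ind (S_meas hS_adapted le_rfl i') _
  have hnn : ∀ l ω i', 0 ≤ ϑ l ω i' := by
    intro l ω i'
    simp only [ϑ]
    split_ifs <;> simp
  have hz : ∀ l, l ≠ j → ∀ ω i', ϑ l ω i' = 0 := by
    intro l hl ω i'
    simp [ϑ, hl]
  have hw : ∀ M ≤ j, ∀ ω, (gridStrat ℱ k (j + 1) ϑ hϑ).wealth S 0 (gt k M) ω = 0 := by
    intro M hM ω
    rw [gridStrat_wealth _ _ _ _ _ _ _ _ (by omega), zero_add]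
    apply Finset.sum_eq_zero
    intro l hl
    rw [Finset.mem_range] at hl
    apply Finset.sum_eq_zero
    intro i' _
    rw [hz l (by omega)]; simp
  have hadm : (gridStrat ℱ k (j + 1) ϑ hϑ).Admissible P S 0 := by
    intro l hl
    refine Eventually.of_forall fun ω => ⟨fun i' => hnn l ω i', ?_⟩
    have hl' : l < j + 1 := hl
    refine le_of_eq ?_
    refine Eq.trans ?_ (hw l (by omega) ω).symm
    apply Finset.sum_eq_zero
    intro i' _
    change ϑ l ω i' * S (gt k l) ω i' = 0
    simp only [ϑ]
    by_cases h0 : S (gt k l) ω i' = 0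
    · rw [h0]; simp
    · simp [h0]
  have hr := revive (hcr _ ⟨0, le_rfl, _, hadm, rfl⟩)
  filter_upwards [hr] with ω hω hs
  have h1 := hω (gt k j) (gt k (j + 1)) (gt_mono (by omega)) (hw j le_rfl ω)
  rw [gridStrat_wealth _ _ _ _ _ _ _ _ le_rfl, Finset.sum_range_succ,
    Finset.sum_eq_zero (s := Finset.range j)] at h1
  · rw [Finset.sum_eq_single i] at h1
    · simpa [ϑ, hs] using h1
    · intro i' _ hi'
      simp [ϑ, hi']
    · simp
  · intro l hl
    rw [Finset.mem_range] at hl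
    apply Finset.sum_eq_zero
    intro i' _
    rw [hz l (by omega)]; simp

lemma deltaR_eq {d : ℕ} (S : ℝ≥0 → Ω → Fin d → ℝ) (k j : ℕ) (ω : Ω) (i : Fin d) :
    deltaR S k (j + 1) ω i = if 0 < S (gt k j) ω i then
      S (gt k (j + 1)) ω i / S (gt k j) ω i - 1 else 0 := rfl

lemma prod_Icc_succ' (f : ℕ → ℝ) (M : ℕ) :
    ∏ u ∈ Finset.Icc 1 (M + 1), f u = (∏ u ∈ Finset.Icc 1 M, f u) * f (M + 1) :=
  Finset.prod_Icc_succ_top (by omega) f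

lemma factor_nonneg {d : ℕ} {S : ℝ≥0 → Ω → Fin d → ℝ} (hS : ∀ t ω i, 0 ≤ S t ω i)
    (k j : ℕ) (ω : Ω) {p : Fin d → ℝ} (hp : p ∈ stdSimplexSet d) :
    0 ≤ 1 + ∑ i, p i * deltaR S k (j + 1) ω i := by
  have h : ∑ i, p i * (-1) ≤ ∑ i, p i * deltaR S k (j + 1) ω i := by
    apply Finset.sum_le_sum
    intro i _
    apply mul_le_mul_of_nonneg_left _ (hp.1 i)
    rw [deltaR_eq]
    split_ifs
    · have := div_nonneg (hS (gt k (j + 1)) ω i) (hS (gt k j) ω i)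
      linarith
    · norm_num
  rw [← Finset.sum_mul] at h
  have := hp.2
  linarith

theorem partA (P : MeasureTheory.Measure Ω) (ℱ : MeasureTheory.Filtration ℝ≥0 m)
    (d : ℕ) (S : ℝ≥0 → Ω → Fin d → ℝ)
    (hS_adapted : MeasureTheory.StronglyAdapted ℱ S)
    (hS_nonneg : ∀ t ω i, 0 ≤ S t ω i) (k : ℕ)
    (π : ℕ → Ω → Fin d → ℝ)
    (hπ : ∀ u : ℕ, 1 ≤ u → u ≤ k * 2 ^ k → Measurable[ℱ (gt k (u - 1))] (π u))
    (hs : ∀ u : ℕ, 1 ≤ u → u ≤ k * 2 ^ k → ∀ ω, π u ω ∈ stdSimplexSet d) :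
    ∃ X ∈ Xsk P ℱ S k, ∀ᵐ ω ∂P, ∀ M : ℕ, M ≤ k * 2 ^ k →
        X (gt k M) ω
          = ∏ u ∈ Finset.Icc 1 M, (1 + ∑ i, π u ω i * deltaR S k u ω i) := by
  classical
  set K := k * 2 ^ k with hK
  let W : ℕ → Ω → ℝ := fun M ω => ∏ u ∈ Finset.Icc 1 M, (1 + ∑ i, π u ω i * deltaR S k u ω i)
  let ϑ : ℕ → Ω → Fin d → ℝ := fun j ω i =>
    if j < K then (if 0 < S (gt k j) ω i then (π (j + 1) ω i * W j ω) / S (gt k j) ω i else 0)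
    else 0
  have hWm : ∀ j ≤ K, Measurable[ℱ (gt k j)] (W j) := by
    intro j hj
    apply meas_prod
    intro u hu
    rw [Finset.mem_Icc] at hu
    obtain ⟨v, rfl⟩ : ∃ v, u = v + 1 := ⟨u - 1, by omega⟩
    refine Measurable.const_add (meas_sum fun i _ => ?_) 1
    refine Measurable.mul ?_ ?_
    · exact ((measurable_pi_apply i).comp (hπ (v + 1) hu.1 (by omega))).mono
        (ℱ.mono (gt_mono (by omega))) le_rfl
    · exact meas_delta (S_meas hS_adapted (gt_mono (by omega)) i)
        (S_meas hS_adapted (gt_mono (by omega)) i)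
  have hϑ : ∀ l, Measurable[ℱ (gt k l)] (ϑ l) := by
    intro l
    refine @measurable_pi_lambda _ _ _ (ℱ (gt k l)) _ _ fun i => ?_
    by_cases hl : l < K
    · simp only [ϑ, hl, if_true]
      refine meas_hold (S_meas hS_adapted le_rfl i) (Measurable.mul ?_ (hWm l hl.le))
      exact (measurable_pi_apply i).comp (hπ (l + 1) (by omega) (by omega))
    · simp only [ϑ, hl, if_false]
      exact measurable_const
  have hWnn : ∀ j ≤ K, ∀ ω, 0 ≤ W j ω := by
    intro j hj ω
    apply Finset.prod_nonneg
    intro u hu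
    rw [Finset.mem_Icc] at hu
    obtain ⟨v, rfl⟩ : ∃ v, u = v + 1 := ⟨u - 1, by omega⟩
    exact factor_nonneg hS_nonneg k v ω (hs _ hu.1 (by omega) ω)
  have hwealth : ∀ M ≤ K, ∀ ω, (gridStrat ℱ k K ϑ hϑ).wealth S 1 (gt k M) ω = W M ω := by
    intro M hM ω
    rw [gridStrat_wealth _ _ _ _ _ _ _ _ hM]
    induction M with
    | zero => simp [W]
    | succ M ih =>
      rw [Finset.sum_range_succ, ← add_assoc, ih (by omega)]
      change _ = ∏ u ∈ Finset.Icc 1 (M + 1), (1 + ∑ i, π u ω i * deltaR S k u ω i)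
      rw [prod_Icc_succ']
      change _ = W M ω * _
      rw [mul_add, mul_one, Finset.mul_sum]
      congr 1
      apply Finset.sum_congr rfl
      intro i _
      rw [deltaR_eq]
      have hM' : M < K := by omega
      simp only [ϑ, hM', if_true]
      split_ifs with h
      · field_simp
      · simp
  refine ⟨_, ⟨gridStrat ℱ k K ϑ hϑ, ?_, ?_, rfl⟩, Eventually.of_forall fun ω M hM => hwealth M hM ω⟩
  · intro j hj
    have hj : j < K := hj
    refine Eventually.of_forall fun ω => ?_
    have hsx := hs (j + 1) (by omega) (by omega) ω
    have hW := hWnn j hj.le ω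
    refine ⟨fun i => ?_, ?_⟩
    · change 0 ≤ ϑ j ω i
      simp only [ϑ, hj, if_true]
      split_ifs with h
      · exact div_nonneg (mul_nonneg (hsx.1 i) hW) h.le
      · exact le_rfl
    · refine le_of_le_of_eq ?_ (hwealth j hj.le ω).symm
      calc ∑ i, ϑ j ω i * S (gt k j) ω i ≤ ∑ i, π (j + 1) ω i * W j ω := by
            apply Finset.sum_le_sum
            intro i _
            simp only [ϑ, hj, if_true]
            split_ifs with h
            · rw [div_mul_cancel₀ _ h.ne']
            · rw [zero_mul]; exact mul_nonneg (hsx.1 i) hW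
        _ = (∑ i, π (j + 1) ω i) * W j ω := by rw [Finset.sum_mul]
        _ ≤ 1 * W j ω := mul_le_mul_of_nonneg_right hsx.2 hW
        _ = W j ω := one_mul _
  · intro j hj ω
    exact ⟨j, hj, rfl⟩

/-- holdings of `θ` just after time `t` -/
def hold {ℱ : MeasureTheory.Filtration ℝ≥0 m} {d : ℕ} (θ : SimpleStrategy ℱ d) (t : ℝ≥0)
    (ω : Ω) (i : Fin d) : ℝ :=
  ∑ j ∈ Finset.range θ.n, if θ.τ j ω ≤ t ∧ t < θ.τ (j + 1) ω then θ.ϑ j ω i else 0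

lemma hold_meas {ℱ : MeasureTheory.Filtration ℝ≥0 m} {d : ℕ} (θ : SimpleStrategy ℱ d) (t : ℝ≥0)
    (i : Fin d) : Measurable[ℱ t] (fun ω => hold θ t ω i) := by
  apply meas_sum
  intro j _
  have hst : ∀ j, MeasurableSet[ℱ t] {ω | θ.τ j ω ≤ t} := by
    intro j
    have := θ.τ_stopping j t
    simpa only [WithTop.coe_le_coe] using this
  have h1 : ∀ B : Set ℝ, MeasurableSet B →
      MeasurableSet[ℱ t] ({ω | θ.ϑ j ω i ∈ B} ∩ {ω | θ.τ j ω ≤ t}) := by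
    intro B hB
    have := (((measurable_pi_apply i).comp (θ.ϑ_meas j)) hB).2 t
    simp only [WithTop.coe_le_coe] at this
    exact this
  have h2 : Measurable[ℱ t] (fun ω => if θ.τ j ω ≤ t then θ.ϑ j ω i else 0) := by
    intro B hB
    have heq : (fun ω => if θ.τ j ω ≤ t then θ.ϑ j ω i else 0) ⁻¹' B =
        ({ω | θ.ϑ j ω i ∈ B} ∩ {ω | θ.τ j ω ≤ t}) ∪
          ({ω | θ.τ j ω ≤ t}ᶜ ∩ {_ω | (0 : ℝ) ∈ B}) := by
      ext ω
      by_cases h : θ.τ j ω ≤ t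
      · simp [h]
      · simp [h]
    rw [heq]
    exact (h1 B hB).union ((hst j).compl.inter (MeasurableSet.const _))
  have h3 : (fun ω => if θ.τ j ω ≤ t ∧ t < θ.τ (j + 1) ω then θ.ϑ j ω i else 0) =
      fun ω => if θ.τ (j + 1) ω ≤ t then 0 else (if θ.τ j ω ≤ t then θ.ϑ j ω i else 0) := by
    funext ω
    by_cases h : θ.τ (j + 1) ω ≤ t
    · simp [h]
    · simp [not_le.1 h]
  rw [h3]
  exact Measurable.ite (hst (j + 1)) measurable_const h2

lemma step {ℱ : MeasureTheory.Filtration ℝ≥0 m} {d : ℕ} (θ : SimpleStrategy ℱ d) (k : ℕ)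
    (hg : ∀ j ≤ θ.n, ∀ ω, θ.τ j ω ∈ dyadicGrid k) (S : ℝ≥0 → Ω → Fin d → ℝ) (x : ℝ) (M : ℕ)
    (ω : Ω) :
    θ.wealth S x (gt k (M + 1)) ω = θ.wealth S x (gt k M) ω +
      ∑ i, hold θ (gt k M) ω i * (S (gt k (M + 1)) ω i - S (gt k M) ω i) := by
  unfold SimpleStrategy.wealth hold
  simp_rw [Finset.sum_mul]
  rw [Finset.sum_comm (s := Finset.univ), add_assoc, ← Finset.sum_add_distrib]
  congr 1
  apply Finset.sum_congr rfl
  intro j hj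
  rw [Finset.mem_range] at hj
  rw [← Finset.sum_add_distrib]
  apply Finset.sum_congr rfl
  intro i _
  obtain ⟨a, -, ha⟩ := hg j hj.le ω
  obtain ⟨b, -, hb⟩ := hg (j + 1) hj ω
  have hab := θ.τ_mono j ω
  change _ = gt k a at ha
  change _ = gt k b at hb
  rw [ha, hb, gt_le_iff] at hab
  rw [ha, hb]
  have hc : (gt k a ≤ gt k M ∧ gt k M < gt k b) ↔ (a ≤ M ∧ ¬ b ≤ M) := by
    rw [gt_le_iff, ← not_le, gt_le_iff]
  by_cases h1 : b ≤ M
  · rw [min_eq_left (gt_mono (by omega)), min_eq_left (gt_mono (by omega)),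
      min_eq_left (gt_mono (by omega)), min_eq_left (gt_mono (by omega)), if_neg (by rw [hc]; omega)]
    ring
  · by_cases h2 : a ≤ M
    · rw [min_eq_right (gt_mono (by omega)), min_eq_left (gt_mono (by omega)),
        min_eq_right (gt_mono (by omega)), min_eq_left (gt_mono (by omega)), if_pos (by rw [hc]; omega)]
      ring
    · rw [min_eq_right (gt_mono (by omega)), min_eq_right (gt_mono (by omega)),
        min_eq_right (gt_mono (by omega)), min_eq_right (gt_mono (by omega)), if_neg (by rw [hc]; omega)]
      ring

lemma wealth_zero {ℱ : MeasureTheory.Filtration ℝ≥0 m} {d : ℕ} (θ : SimpleStrategy ℱ d)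
    (S : ℝ≥0 → Ω → Fin d → ℝ) (x : ℝ) (ω : Ω) : θ.wealth S x 0 ω = x := by
  simp [SimpleStrategy.wealth]

lemma tau_monotone {ℱ : MeasureTheory.Filtration ℝ≥0 m} {d : ℕ} (θ : SimpleStrategy ℱ d) (ω : Ω) :
    Monotone (fun j => θ.τ j ω) := monotone_nat_of_le_succ fun j => θ.τ_mono j ω

lemma active {ℱ : MeasureTheory.Filtration ℝ≥0 m} {d : ℕ} (θ : SimpleStrategy ℱ d)
    (S : ℝ≥0 → Ω → Fin d → ℝ) (x : ℝ) (ω : Ω) (t : ℝ≥0) (j : ℕ) (hj : j < θ.n)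
    (h1 : θ.τ j ω ≤ t) (h2 : t < θ.τ (j + 1) ω) :
    (∀ i, hold θ t ω i = θ.ϑ j ω i) ∧
    θ.wealth S x t ω = θ.wealth S x (θ.τ j ω) ω +
      ∑ i, θ.ϑ j ω i * (S t ω i - S (θ.τ j ω) ω i) := by
  have hmono := tau_monotone θ ω
  constructor
  · intro i
    unfold hold
    rw [Finset.sum_eq_single j]
    · simp [h1, h2]
    · intro l _ hl
      rw [if_neg]
      rintro ⟨ha, hb⟩
      rcases lt_or_gt_of_ne hl with h | h
      · exact absurd (lt_of_lt_of_le hb (hmono (show l + 1 ≤ j from h))) (not_lt.2 h1)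
      · exact absurd (lt_of_lt_of_le h2 (hmono (show j + 1 ≤ l from h))) (not_lt.2 ha)
    · intro h; simp [hj] at h
  · unfold SimpleStrategy.wealth
    rw [add_assoc]
    congr 1
    rw [← sub_eq_iff_eq_add', ← Finset.sum_sub_distrib, Finset.sum_eq_single j]
    · rw [← Finset.sum_sub_distrib]
      apply Finset.sum_congr rfl
      intro i _
      rw [min_eq_right h2.le, min_eq_left h1, min_eq_right (θ.τ_mono j ω), min_self]
      ring
    · intro l _ hl
      rw [sub_eq_zero]
      apply Finset.sum_congr rfl
      intro i _
      rcases lt_or_gt_of_ne hl with h | h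
      · have e1 : θ.τ (l + 1) ω ≤ θ.τ j ω := hmono (show l + 1 ≤ j from h)
        have e2 : θ.τ l ω ≤ θ.τ j ω := hmono h.le
        rw [min_eq_left e1, min_eq_left e2, min_eq_left (e1.trans h1), min_eq_left (e2.trans h1)]
      · have e1 : t ≤ θ.τ l ω := h2.le.trans (hmono (show j + 1 ≤ l from h))
        have e2 : t ≤ θ.τ (l + 1) ω := e1.trans (θ.τ_mono l ω)
        rw [min_eq_right e1, min_eq_right e2, min_eq_right (h1.trans e1),
          min_eq_right (h1.trans e2)]
        simp
    · intro h; simp [hj] at h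

theorem partB (P : MeasureTheory.Measure Ω) (ℱ : MeasureTheory.Filtration ℝ≥0 m)
    (d : ℕ) (S : ℝ≥0 → Ω → Fin d → ℝ)
    (hS_adapted : MeasureTheory.StronglyAdapted ℱ S)
    (hS_nonneg : ∀ t ω i, 0 ≤ S t ω i)
    (hcr : ∀ X ∈ XsAll P ℱ S, CannotRevive P X) (k : ℕ)
    (X : ℝ≥0 → Ω → ℝ) (hX : X ∈ Xsk P ℱ S k) :
    ∃ π : ℕ → Ω → Fin d → ℝ,
      (∀ u : ℕ, 1 ≤ u → u ≤ k * 2 ^ k → Measurable[ℱ (gt k (u - 1))] (π u)) ∧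
      (∀ u : ℕ, 1 ≤ u → u ≤ k * 2 ^ k → ∀ ω, π u ω ∈ stdSimplexSet d) ∧
      ∀ᵐ ω ∂P, ∀ M : ℕ, M ≤ k * 2 ^ k →
        X (gt k M) ω
          = ∏ u ∈ Finset.Icc 1 M, (1 + ∑ i, π u ω i * deltaR S k u ω i) := by
  classical
  obtain ⟨θ, hadm, hg, rfl⟩ := hX
  have hr := revive (hcr _ ⟨1, zero_le_one, θ, hadm, rfl⟩)
  have hdead : ∀ᵐ ω ∂P, ∀ j i, S (gt k j) ω i = 0 → S (gt k (j + 1)) ω i = 0 := by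
    rw [ae_all_iff]; intro j
    rw [ae_all_iff]; intro i
    exact S_dead hS_adapted hcr k j i
  have hadm' : ∀ᵐ ω ∂P, ∀ j, j < θ.n → (∀ i, 0 ≤ θ.ϑ j ω i) ∧
      ∑ i, θ.ϑ j ω i * S (θ.τ j ω) ω i ≤ θ.wealth S 1 (θ.τ j ω) ω := by
    rw [ae_all_iff]; intro j
    by_cases hj : j < θ.n
    · filter_upwards [hadm j hj] with ω hω _ using hω
    · exact Eventually.of_forall fun ω h => absurd h hj
  let W : ℕ → Ω → ℝ := fun M ω => θ.wealth S 1 (gt k M) ω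
  have hWm : ∀ M, Measurable[ℱ (gt k M)] (W M) := by
    intro M
    induction M with
    | zero =>
      have : W 0 = fun _ => 1 := by
        funext ω
        simp only [W, gt_zero, wealth_zero]
      rw [this]
      exact measurable_const
    | succ M ih =>
      have : W (M + 1) = fun ω => W M ω +
          ∑ i, hold θ (gt k M) ω i * (S (gt k (M + 1)) ω i - S (gt k M) ω i) := by
        funext ω
        exact step θ k hg S 1 M ω
      rw [this]
      have hle : gt k M ≤ gt k (M + 1) := gt_mono (by omega)
      refine Measurable.add (ih.mono (ℱ.mono hle) le_rfl) (meas_sum fun i _ => ?_)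
      exact ((hold_meas θ _ i).mono (ℱ.mono hle) le_rfl).mul
        ((S_meas hS_adapted le_rfl i).sub (S_meas hS_adapted hle i))
  let q : ℕ → Ω → Fin d → ℝ := fun j ω i => hold θ (gt k j) ω i * S (gt k j) ω i / W j ω
  have hqm : ∀ j, Measurable[ℱ (gt k j)] (q j) := fun j =>
    @measurable_pi_lambda _ _ _ (ℱ (gt k j)) _ _ fun i =>
      ((hold_meas θ _ i).mul (S_meas hS_adapted le_rfl i)).div (hWm j)
  have hsm : MeasurableSet (stdSimplexSet d) := by
    have : stdSimplexSet d = (⋂ i, {z : Fin d → ℝ | 0 ≤ z i}) ∩ {z | ∑ i, z i ≤ 1} := by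
      ext z; simp [stdSimplexSet]
    rw [this]
    refine MeasurableSet.inter (MeasurableSet.iInter fun i => ?_) ?_
    · exact measurableSet_le measurable_const (measurable_pi_apply i)
    · exact measurableSet_le (Finset.measurable_sum _ fun i _ => measurable_pi_apply i)
        measurable_const
  refine ⟨fun u ω => if q (u - 1) ω ∈ stdSimplexSet d then q (u - 1) ω else 0, ?_, ?_, ?_⟩
  · intro u _ _
    exact Measurable.ite (hqm (u - 1) hsm) (hqm (u - 1)) measurable_const
  · intro u _ _ ω
    simp only
    split_ifs with h
    · exact h
    · simp [stdSimplexSet]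
  · filter_upwards [hr, hdead, hadm'] with ω hrω hdω haω
    have hHnn : ∀ t i, 0 ≤ hold θ t ω i := by
      intro t i
      apply Finset.sum_nonneg
      intro j hj
      split_ifs
      · exact (haω j (Finset.mem_range.1 hj)).1 i
      · exact le_rfl
    have hbudget : ∀ t, 0 ≤ θ.wealth S 1 t ω →
        ∑ i, hold θ t ω i * S t ω i ≤ θ.wealth S 1 t ω := by
      intro t ht
      by_cases hact : ∃ j, j < θ.n ∧ θ.τ j ω ≤ t ∧ t < θ.τ (j + 1) ω
      · obtain ⟨j, hj, h1, h2⟩ := hact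
        obtain ⟨hH, hw⟩ := active θ S 1 ω t j hj h1 h2
        rw [hw]
        simp_rw [hH, mul_sub]
        rw [Finset.sum_sub_distrib]
        linarith [(haω j hj).2]
      · have hH : ∀ i, hold θ t ω i = 0 := by
          intro i
          apply Finset.sum_eq_zero
          intro j hj
          rw [if_neg]
          intro h
          exact hact ⟨j, Finset.mem_range.1 hj, h⟩
        simp [hH, ht]
    have hnn : ∀ M, 0 ≤ W M ω := by
      intro M
      induction M with
      | zero => simp only [W, gt_zero, wealth_zero]; exact zero_le_one
      | succ M ih =>
        have h1 := hbudget (gt k M) ih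
        have h2 := step θ k hg S 1 M ω
        simp_rw [mul_sub] at h2
        rw [Finset.sum_sub_distrib] at h2
        have h3 : 0 ≤ ∑ i, hold θ (gt k M) ω i * S (gt k (M + 1)) ω i :=
          Finset.sum_nonneg fun i _ => mul_nonneg (hHnn _ i) (hS_nonneg _ _ _)
        change 0 ≤ θ.wealth S 1 (gt k (M + 1)) ω
        linarith
    intro M _
    change W M ω = _
    induction M with
    | zero => simp [W, gt_zero, wealth_zero]
    | succ M ih =>
      have ih := ih (by omega)
      rw [prod_Icc_succ', ← ih]
      simp only [Nat.add_sub_cancel]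
      rcases (hnn M).eq_or_lt with h0 | hpos
      · rw [← h0, zero_mul]
        exact hrω (gt k M) (gt k (M + 1)) (gt_mono (by omega)) h0.symm
      · have hq : q M ω ∈ stdSimplexSet d := by
          refine ⟨fun i => div_nonneg (mul_nonneg (hHnn _ i) (hS_nonneg _ _ _)) hpos.le, ?_⟩
          simp only [q]
          rw [← Finset.sum_div, div_le_one hpos]
          exact hbudget _ (hnn M)
        rw [if_pos hq]
        have h2 : W (M + 1) ω = _ := step θ k hg S 1 M ω
        rw [h2, mul_add, mul_one, Finset.mul_sum]
        change W M ω + _ = _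
        congr 1
        apply Finset.sum_congr rfl
        intro i _
        rw [deltaR_eq]
        simp only [q]
        split_ifs with h
        · field_simp
        · have hz : S (gt k M) ω i = 0 := le_antisymm (not_lt.1 h) (hS_nonneg _ _ _)
          rw [hdω M i hz, hz]
          simp

end MC

/-- **Multiplicative characterization of `𝒳_s^k(1)`.** Assuming no wealth process in `𝒳_s` can
revive from bankruptcy: (a) every collection `π` of predictable simplex-valued proportions
generates an element of `𝒳_s^k(1)` whose grid values are `∏ (1 + ⟨π_u, ΔR_u⟩)`; and (b) every
element of `𝒳_s^k(1)` arises this way. -/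
theorem multiplicative_characterization
    {Ω : Type*} {m : MeasurableSpace Ω} (P : MeasureTheory.Measure Ω)
    [MeasureTheory.IsProbabilityMeasure P] (ℱ : MeasureTheory.Filtration ℝ≥0 m)
    (hright : RightContinuousFiltration ℱ) (hcompl : CompleteFiltration ℱ P)
    (d : ℕ) (S : ℝ≥0 → Ω → Fin d → ℝ)
    (hS_adapted : MeasureTheory.StronglyAdapted ℱ S)
    (hS_cadlag : ∀ ω, IsCadlag (fun t => S t ω))
    (hS_nonneg : ∀ t ω i, 0 ≤ S t ω i)
    (hcr : ∀ X ∈ XsAll P ℱ S, CannotRevive P X) (k : ℕ) :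
    (∀ π : ℕ → Ω → Fin d → ℝ,
      (∀ u : ℕ, 1 ≤ u → u ≤ k * 2 ^ k →
        Measurable[ℱ (((u - 1 : ℕ) : ℝ≥0) / 2 ^ k)] (π u)) →
      (∀ u : ℕ, 1 ≤ u → u ≤ k * 2 ^ k → ∀ ω, π u ω ∈ stdSimplexSet d) →
      ∃ X ∈ Xsk P ℱ S k, ∀ᵐ ω ∂P, ∀ M : ℕ, M ≤ k * 2 ^ k →
        X ((M : ℝ≥0) / 2 ^ k) ω
          = ∏ u ∈ Finset.Icc 1 M, (1 + ∑ i, π u ω i * deltaR S k u ω i)) ∧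
    (∀ X ∈ Xsk P ℱ S k, ∃ π : ℕ → Ω → Fin d → ℝ,
      (∀ u : ℕ, 1 ≤ u → u ≤ k * 2 ^ k →
        Measurable[ℱ (((u - 1 : ℕ) : ℝ≥0) / 2 ^ k)] (π u)) ∧
      (∀ u : ℕ, 1 ≤ u → u ≤ k * 2 ^ k → ∀ ω, π u ω ∈ stdSimplexSet d) ∧
      ∀ᵐ ω ∂P, ∀ M : ℕ, M ≤ k * 2 ^ k →
        X ((M : ℝ≥0) / 2 ^ k) ω
          = ∏ u ∈ Finset.Icc 1 M, (1 + ∑ i, π u ω i * deltaR S k u ω i)) := by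
  exact ⟨fun π h1 h2 => MC.partA P ℱ d S hS_adapted hS_nonneg k π h1 h2,
    fun X hX => MC.partB P ℱ d S hS_adapted hS_nonneg hcr k X hX⟩

end
end

section
/- Assume condition NA1_s holds. Then every X ∈ 𝒳_s cannot revive from bankruptcy; that is, almost surely, X_t = 0 holds for all t ≥ ζ^X on the event {ζ^X < ∞}. -/
open MeasureTheory Set Filter
open scoped NNReal ENNReal Topology

noncomputable section

variable {Ω : Type*} {m : MeasurableSpace Ω}

namespace ReviveAux

/-- Right-continuous functions take values near `f r` at points of a dense set right of `r`. -/
lemma exists_dense_right {f : ℝ≥0 → ℝ} (hf : ∀ t, ContinuousWithinAt f (Set.Ici t) t)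
    {D : Set ℝ≥0} (hD : Dense D) {U : Set ℝ} (hU : IsOpen U) {r T : ℝ≥0} (hr : f r ∈ U)
    (hT : r < T) : ∃ q ∈ D, r < q ∧ q < T ∧ f q ∈ U := by
  have h1 : f ⁻¹' U ∈ 𝓝[≥] r := hf r (hU.mem_nhds hr)
  obtain ⟨u, hu, hsub⟩ := (mem_nhdsGE_iff_exists_Ico_subset' hT).1 h1
  have : r < min u T := lt_min hu hT
  obtain ⟨q, hq, hrq, hq2⟩ := hD.exists_between this
  exact ⟨q, hq, hrq, hq2.trans_le (min_le_right _ _), hsub ⟨hrq.le, hq2.trans_le (min_le_left _ _)⟩⟩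

/-- Near bankruptcy the path takes small values. -/
lemma exists_small {f : ℝ≥0 → ℝ} {s : ℝ≥0} (hs : Function.leftLim f s = 0 ∨ f s = 0)
    {ε : ℝ} (hε : 0 < ε) : ∃ r ≤ s, f r < ε := by
  rcases hs with hs | hs
  · by_cases h0 : 𝓝[<] s = ⊥
    · rw [leftLim_eq_of_eq_bot f h0] at hs
      exact ⟨s, le_rfl, by rw [hs]; exact hε⟩
    · by_cases hl : ∃ y, Tendsto f (𝓝[<] s) (𝓝 y)
      · obtain ⟨y, hy⟩ := hl
        have : (𝓝[<] s).NeBot := ⟨h0⟩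
        rw [leftLim_eq_of_tendsto hy] at hs
        subst hs
        have h1 := hy.eventually (gt_mem_nhds hε)
        obtain ⟨r, hr, hr2⟩ := (h1.and self_mem_nhdsWithin).exists
        exact ⟨r, le_of_lt hr2, hr⟩
      · rw [leftLim_eq_of_not_tendsto f hl] at hs
        exact ⟨s, le_rfl, by rw [hs]; exact hε⟩
  · exact ⟨s, le_rfl, by rw [hs]; exact hε⟩

lemma path_final {f : ℝ≥0 → ℝ} (hf : ∀ t, ContinuousWithinAt f (Set.Ici t) t)
    (h0 : ∀ t, 0 ≤ f t) {D : Set ℝ≥0} (hD : Dense D)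
    (hz : ∀ T ∈ D, (∀ n : ℕ, ∃ q ∈ D, q < T ∧ f q < 1 / ((n : ℝ) + 1)) → f T = 0)
    (t : ℝ≥0)
    (ht : sInf ((fun t : ℝ≥0 => (t : ℝ≥0∞)) ''
      {t : ℝ≥0 | Function.leftLim f t = 0 ∨ f t = 0}) ≤ (t : ℝ≥0∞)) : f t = 0 := by
  by_contra hne
  have hpos : 0 < f t := lt_of_le_of_ne (h0 t) (Ne.symm hne)
  obtain ⟨T, hTD, htT, -, hfT⟩ := exists_dense_right hf hD isOpen_Ioi (r := t) (T := t + 1)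
    (show f t ∈ Ioi 0 from hpos) (by simp)
  have hlt := ht.trans_lt (ENNReal.coe_lt_coe.2 htT)
  obtain ⟨_, ⟨s, hs, rfl⟩, hsT⟩ := sInf_lt_iff.1 hlt
  have hsT' : s < T := ENNReal.coe_lt_coe.1 hsT
  refine (ne_of_gt hfT) (hz T hTD fun n => ?_)
  obtain ⟨r, hr, hr2⟩ := exists_small hs (ε := 1 / ((n : ℝ) + 1)) (by positivity)
  obtain ⟨q, hq, -, hqT, hfq⟩ := exists_dense_right hf hD isOpen_Iio
    (show f r ∈ Iio _ from hr2) (hr.trans_lt hsT')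
  exact ⟨q, hq, hqT, hfq⟩

/-- Sampling a right-continuous process at a bounded random time is measurable. -/
lemma measurable_sample {Ω : Type*} {m' : MeasurableSpace Ω} {f : ℝ≥0 → Ω → ℝ} {t : ℝ≥0}
    (hm : ∀ s ≤ t, Measurable (f s))
    (hf : ∀ ω s, ContinuousWithinAt (fun u => f u ω) (Set.Ici s) s)
    {ρ : Ω → ℝ≥0} (hρ : Measurable ρ) (hρt : ∀ ω, ρ ω ≤ t) :
    Measurable (fun ω => f (ρ ω) ω) := by
  let g : ℕ → ℕ → ℝ≥0 := fun n k => min t (((k : ℝ≥0) + 1) / ((n : ℝ≥0) + 1))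
  let N : ℕ → Ω → ℕ := fun n ω => ⌊((n : ℝ≥0) + 1) * ρ ω⌋₊
  have hN : ∀ n, Measurable (N n) := fun n =>
    Nat.measurable_floor.comp (measurable_const.mul hρ)
  refine measurable_of_tendsto_metrizable (f := fun n ω => f (g n (N n ω)) ω) (fun n => ?_) ?_
  · have h1 : Measurable (fun p : ℕ × Ω => f (g n p.1) p.2) :=
      measurable_from_prod_countable_right fun k => by
        have h0 : Measurable (f (g n k)) := hm _ (min_le_left _ _)
        exact h0
    have h2 : Measurable (fun ω => (N n ω, ω)) := (hN n).prodMk measurable_id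
    have h3 := h1.comp h2
    exact h3
  · rw [tendsto_pi_nhds]
    intro ω
    have hge : ∀ n, ρ ω ≤ g n (N n ω) := by
      intro n
      refine le_min (hρt ω) ?_
      rw [le_div_iff₀ (by positivity), mul_comm]
      exact (Nat.lt_floor_add_one _).le
    have hle : ∀ n, g n (N n ω) ≤ ρ ω + 1 / ((n : ℝ≥0) + 1) := by
      intro n
      refine (min_le_right _ _).trans ?_
      rw [add_div]
      gcongr
      rw [div_le_iff₀ (by positivity), mul_comm (ρ ω)]
      exact Nat.floor_le (by positivity)
    have hlim : Tendsto (fun n => g n (N n ω)) atTop (𝓝 (ρ ω)) := by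
      refine tendsto_of_tendsto_of_tendsto_of_le_of_le tendsto_const_nhds ?_ hge hle
      have := (tendsto_one_div_add_atTop_nhds_zero_nat (𝕜 := ℝ≥0)).const_add (ρ ω)
      simpa using this
    exact (hf ω (ρ ω)).tendsto.comp
      (tendsto_nhdsWithin_iff.2 ⟨hlim, Eventually.of_forall hge⟩)

variable {Ω : Type*} {m : MeasurableSpace Ω} {ℱ : Filtration ℝ≥0 m}

lemma measurable_indicator_le {τ : Ω → ℝ≥0}
    (hτ : IsStoppingTime ℱ (fun ω => (τ ω : WithTop ℝ≥0))) {g : Ω → ℝ}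
    (hg : Measurable[hτ.measurableSpace] g) (t : ℝ≥0) :
    Measurable[ℱ t] (Set.indicator {ω | τ ω ≤ t} g) := by
  have hset : {ω | (τ ω : WithTop ℝ≥0) ≤ t} = {ω | τ ω ≤ t} := by
    ext ω; exact WithTop.coe_le_coe
  have hA : MeasurableSet[ℱ t] {ω | τ ω ≤ t} := by
    rw [← hset]; exact hτ t
  intro s hs
  have h1 := (hg hs).2 t
  rw [hset] at h1
  rw [Set.indicator_preimage, Set.ite]
  refine MeasurableSet.union h1 (MeasurableSet.diff ?_ hA)
  exact (@measurable_const _ _ _ (ℱ t) (0 : ℝ)) hs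

lemma measurable_min_time {τ : Ω → ℝ≥0}
    (hτ : IsStoppingTime ℱ (fun ω => (τ ω : WithTop ℝ≥0))) (t : ℝ≥0) :
    Measurable[ℱ t] (fun ω => min (τ ω) t) := by
  refine measurable_of_Iic (fun a => ?_)
  by_cases h : t ≤ a
  · have : (fun ω => min (τ ω) t) ⁻¹' Iic a = univ := by ext ω; simp [h]
    rw [this]; exact @MeasurableSet.univ _ (ℱ t)
  · have : (fun ω => min (τ ω) t) ⁻¹' Iic a = {ω | (τ ω : WithTop ℝ≥0) ≤ a} := by
      ext ω
      have h2 : ((τ ω : WithTop ℝ≥0) ≤ a) ↔ τ ω ≤ a := WithTop.coe_le_coe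
      simp only [Set.mem_preimage, Set.mem_Iic, min_le_iff, h, or_false]
      exact h2.symm
    rw [this]
    exact ℱ.mono (not_le.1 h).le _ (hτ a)

variable {d : ℕ} {S : ℝ≥0 → Ω → Fin d → ℝ}

lemma right_cont_coord (hS : ∀ ω, IsCadlag (fun t => S t ω)) (i : Fin d) (ω : Ω) (s : ℝ≥0) :
    ContinuousWithinAt (fun u => S u ω i) (Set.Ici s) s :=
  (continuous_apply i).continuousAt.comp_continuousWithinAt ((hS ω).1 s)

lemma measurable_wealth (hS_adapted : StronglyAdapted ℱ S)
    (hS : ∀ ω, IsCadlag (fun t => S t ω)) (θ : SimpleStrategy ℱ d) (x : ℝ) (t : ℝ≥0) :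
    Measurable[ℱ t] (θ.wealth S x t) := by
  have hsamp : ∀ j i, Measurable[ℱ t] (fun ω => S (min (θ.τ j ω) t) ω i) := by
    intro j i
    refine @measurable_sample Ω (ℱ t) (fun s ω => S s ω i) t ?_ ?_ _
      (measurable_min_time (θ.τ_stopping j) t) (fun ω => min_le_right _ _)
    · intro s hs
      have h1 : Measurable[ℱ s] (S s) := (hS_adapted s).measurable
      exact ((measurable_pi_apply i).comp h1).mono (ℱ.mono hs) le_rfl
    · exact fun ω s => right_cont_coord hS i ω s
  have heq : θ.wealth S x t = fun ω => x + ∑ j ∈ Finset.range θ.n, ∑ i,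
      Set.indicator {ω | θ.τ j ω ≤ t} (fun ω => θ.ϑ j ω i) ω *
      (S (min (θ.τ (j + 1) ω) t) ω i - S (min (θ.τ j ω) t) ω i) := by
    funext ω
    unfold SimpleStrategy.wealth
    congr 1
    refine Finset.sum_congr rfl fun j _ => Finset.sum_congr rfl fun i _ => ?_
    by_cases h : θ.τ j ω ≤ t
    · rw [Set.indicator_of_mem (by exact h)]
    · have h1 : t ≤ θ.τ j ω := (not_le.1 h).le
      rw [min_eq_right h1, min_eq_right (h1.trans (θ.τ_mono j ω))]
      simp
  rw [heq]
  refine Measurable.const_add ?_ _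
  refine Finset.measurable_sum _ fun j _ => Finset.measurable_sum _ fun i _ => ?_
  refine Measurable.mul ?_ ((hsamp _ i).sub (hsamp _ i))
  exact measurable_indicator_le (θ.τ_stopping j) ((measurable_pi_apply i).comp (θ.ϑ_meas j)) t

lemma right_cont_wealth (hS : ∀ ω, IsCadlag (fun t => S t ω)) (θ : SimpleStrategy ℱ d) (x : ℝ)
    (ω : Ω) (t : ℝ≥0) :
    ContinuousWithinAt (fun t => θ.wealth S x t ω) (Set.Ici t) t := by
  have hc : ∀ (c : ℝ≥0) i, ContinuousWithinAt (fun t => S (min c t) ω i) (Set.Ici t) t := by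
    intro c i
    have h1 : ContinuousWithinAt (fun t : ℝ≥0 => min c t) (Set.Ici t) t :=
      (continuous_const.min continuous_id).continuousWithinAt
    exact (right_cont_coord hS i ω (min c t)).comp h1
      (fun u hu => min_le_min_left c hu)
  unfold SimpleStrategy.wealth
  refine continuousWithinAt_const.add ?_
  refine tendsto_finsetSum _ fun j _ => tendsto_finsetSum _ fun i _ => ?_
  exact continuousWithinAt_const.mul ((hc _ i).sub (hc _ i))

/-- Admissibility at a fixed scenario. -/
def Good (θ : SimpleStrategy ℱ d) (S : ℝ≥0 → Ω → Fin d → ℝ) (x : ℝ) (ω : Ω) : Prop :=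
  ∀ j < θ.n, (∀ i, 0 ≤ θ.ϑ j ω i) ∧
    ∑ i, θ.ϑ j ω i * S (θ.τ j ω) ω i ≤ θ.wealth S x (θ.τ j ω) ω

lemma tau_mono (θ : SimpleStrategy ℱ d) (ω : Ω) : Monotone (fun j => θ.τ j ω) :=
  monotone_nat_of_le_succ fun j => θ.τ_mono j ω

lemma good_between {θ : SimpleStrategy ℱ d} {x : ℝ} {ω : Ω} (h : Good θ S x ω)
    {j : ℕ} (hj : j < θ.n) {t : ℝ≥0} (h1 : θ.τ j ω ≤ t) (h2 : t ≤ θ.τ (j + 1) ω) :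
    ∑ i, θ.ϑ j ω i * S t ω i ≤ θ.wealth S x t ω := by
  have key : θ.wealth S x t ω - θ.wealth S x (θ.τ j ω) ω
      = ∑ i, θ.ϑ j ω i * (S t ω i - S (θ.τ j ω) ω i) := by
    unfold SimpleStrategy.wealth
    rw [add_sub_add_left_eq_sub, ← Finset.sum_sub_distrib,
      Finset.sum_eq_single_of_mem j (Finset.mem_range.2 hj)]
    · rw [← Finset.sum_sub_distrib]
      refine Finset.sum_congr rfl fun i _ => ?_
      rw [min_eq_right h2, min_eq_left h1, min_eq_right (h1.trans h2), min_self]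
      ring
    · intro k _ hk
      rcases lt_or_gt_of_ne hk with hk | hk
      · have a1 : θ.τ k ω ≤ θ.τ j ω := tau_mono θ ω hk.le
        have a2 : θ.τ (k + 1) ω ≤ θ.τ j ω := tau_mono θ ω hk
        rw [min_eq_left (a1.trans h1), min_eq_left (a2.trans h1), min_eq_left a1, min_eq_left a2,
          sub_self]
      · have a1 : θ.τ (j + 1) ω ≤ θ.τ k ω := tau_mono θ ω hk
        have a2 : θ.τ (j + 1) ω ≤ θ.τ (k + 1) ω := tau_mono θ ω (by omega)
        rw [min_eq_right (h2.trans a1), min_eq_right (h2.trans a2),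
          min_eq_right (h1.trans (h2.trans a1)), min_eq_right (h1.trans (h2.trans a2))]
        simp
  have h3 := (h j hj).2
  have h4 : ∑ i, θ.ϑ j ω i * (S t ω i - S (θ.τ j ω) ω i)
      = ∑ i, θ.ϑ j ω i * S t ω i - ∑ i, θ.ϑ j ω i * S (θ.τ j ω) ω i := by
    rw [← Finset.sum_sub_distrib]
    exact Finset.sum_congr rfl fun i _ => by ring
  linarith

lemma wealth_zero (θ : SimpleStrategy ℱ d) (S : ℝ≥0 → Ω → Fin d → ℝ) (x : ℝ) (ω : Ω) :
    θ.wealth S x 0 ω = x := by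
  simp [SimpleStrategy.wealth]

lemma good_nonneg (hS_nonneg : ∀ t ω i, 0 ≤ S t ω i) {θ : SimpleStrategy ℱ d} {x : ℝ}
    (hx : 0 ≤ x) {ω : Ω} (h : Good θ S x ω) (t : ℝ≥0) : 0 ≤ θ.wealth S x t ω := by
  have aux : ∀ k ≤ θ.n, ∀ t ≤ θ.τ k ω, 0 ≤ θ.wealth S x t ω := by
    intro k
    induction k with
    | zero =>
      intro _ t ht
      rw [θ.τ_zero] at ht
      have : t = 0 := le_antisymm ht (bot_le)
      rw [this, wealth_zero]; exact hx
    | succ k ih =>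
      intro hk t ht
      rcases le_total t (θ.τ k ω) with h1 | h1
      · exact ih (by omega) t h1
      · refine le_trans ?_ (good_between h (Nat.lt_of_succ_le hk) h1 ht)
        exact Finset.sum_nonneg fun i _ =>
          mul_nonneg ((h k (Nat.lt_of_succ_le hk)).1 i) (hS_nonneg _ _ _)
  rcases le_total t (θ.τ θ.n ω) with h1 | h1
  · exact aux _ le_rfl t h1
  · have : θ.wealth S x t ω = θ.wealth S x (θ.τ θ.n ω) ω := by
      unfold SimpleStrategy.wealth
      congr 1
      refine Finset.sum_congr rfl fun j hj => Finset.sum_congr rfl fun i _ => ?_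
      have hj' := Finset.mem_range.1 hj
      have a1 : θ.τ j ω ≤ θ.τ θ.n ω := tau_mono θ ω hj'.le
      have a2 : θ.τ (j + 1) ω ≤ θ.τ θ.n ω := tau_mono θ ω hj'
      rw [min_eq_left (a1.trans h1), min_eq_left (a2.trans h1), min_eq_left a1, min_eq_left a2]
    rw [this]
    exact aux _ le_rfl _ le_rfl

/-- Start following `θ` at time `σ`, on the event `σ < T`. -/
def delayed (θ : SimpleStrategy ℱ d) (σ : Ω → ℝ≥0)
    (hσ : IsStoppingTime ℱ (fun ω => (σ ω : WithTop ℝ≥0))) (T : ℝ≥0) : SimpleStrategy ℱ d where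
  n := θ.n + 1
  τ := fun j ω => match j with
    | 0 => 0
    | k + 1 => max (θ.τ k ω) (σ ω)
  ϑ := fun j ω => match j with
    | 0 => 0
    | k + 1 => Set.indicator {ω | σ ω < T ∧ σ ω < θ.τ (k + 1) ω} (θ.ϑ k) ω
  τ_zero := fun ω => rfl
  τ_mono := fun j ω => match j with
    | 0 => bot_le
    | k + 1 => max_le_max (θ.τ_mono k ω) le_rfl
  τ_stopping := fun j => match j with
    | 0 => isStoppingTime_const ℱ 0
    | k + 1 => (θ.τ_stopping k).max hσ
  ϑ_meas := fun j => match j with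
    | 0 => measurable_const
    | k + 1 => by
      have hmax : IsStoppingTime ℱ
          (fun ω => ((max (θ.τ k ω) (σ ω) : ℝ≥0) : WithTop ℝ≥0)) := (θ.τ_stopping k).max hσ
      change Measurable[hmax.measurableSpace]
        (Set.indicator {ω | σ ω < T ∧ σ ω < θ.τ (k + 1) ω} (θ.ϑ k))
      have l1 := (θ.τ_stopping k).measurableSpace_mono hmax
        (fun ω => WithTop.coe_le_coe.2 (le_max_left _ _))
      have l2 := hσ.measurableSpace_mono hmax
        (fun ω => WithTop.coe_le_coe.2 (le_max_right _ _))
      refine Measurable.indicator ((θ.ϑ_meas k).mono l1 le_rfl) ?_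
      refine l2 _ ?_
      have e : {ω | σ ω < T ∧ σ ω < θ.τ (k + 1) ω} = {ω | (σ ω : WithTop ℝ≥0) < T} ∩
          {ω | (θ.τ (k + 1) ω : WithTop ℝ≥0) ≤ σ ω}ᶜ := by
        ext ω
        refine and_congr WithTop.coe_lt_coe.symm ?_
        refine Iff.trans WithTop.coe_lt_coe.symm ?_
        exact not_le.symm
      rw [e]
      exact (hσ.measurableSet_lt' T).inter
        (IsStoppingTime.measurableSet_stopping_time_le (θ.τ_stopping (k + 1)) hσ).compl

lemma split_max (f : ℝ≥0 → ℝ) (a s t : ℝ≥0) :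
    f (min (max a s) t) = f (min a t) + f (min s t) - f (min a (min s t)) := by
  rcases le_total a s with h1 | h1 <;> rcases le_total a t with h2 | h2 <;>
    rcases le_total s t with h3 | h3 <;> simp [*]
  · have e1 : a = t := le_antisymm (h1.trans h3) h2
    subst e1; simp
  · have e1 : a = t := le_antisymm h2 (h3.trans h1)
    rw [e1]

open Classical in
lemma delayed_wealth (θ : SimpleStrategy ℱ d) (σ : Ω → ℝ≥0)
    (hσ : IsStoppingTime ℱ (fun ω => (σ ω : WithTop ℝ≥0))) (T : ℝ≥0)
    (S : ℝ≥0 → Ω → Fin d → ℝ) (x y : ℝ) (t : ℝ≥0) (ω : Ω) :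
    (delayed θ σ hσ T).wealth S y t ω =
      y + if σ ω < T then θ.wealth S x t ω - θ.wealth S x (min (σ ω) t) ω else 0 := by
  unfold SimpleStrategy.wealth
  congr 1
  change ∑ j ∈ Finset.range (θ.n + 1), _ = _
  rw [Finset.sum_range_succ']
  have hz : (∑ i, (delayed θ σ hσ T).ϑ 0 ω i * (S (min ((delayed θ σ hσ T).τ (0 + 1) ω) t) ω i -
      S (min ((delayed θ σ hσ T).τ 0 ω) t) ω i)) = 0 :=
    Finset.sum_eq_zero fun i _ => zero_mul _
  rw [hz, add_zero]
  by_cases hT : σ ω < T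
  · rw [if_pos hT, add_sub_add_left_eq_sub, ← Finset.sum_sub_distrib]
    refine Finset.sum_congr rfl fun k _ => ?_
    rw [← Finset.sum_sub_distrib]
    refine Finset.sum_congr rfl fun i _ => ?_
    change Set.indicator {ω | σ ω < T ∧ σ ω < θ.τ (k + 1) ω} (θ.ϑ k) ω i *
      (S (min (max (θ.τ (k + 1) ω) (σ ω)) t) ω i - S (min (max (θ.τ k ω) (σ ω)) t) ω i) = _
    by_cases h2 : σ ω < θ.τ (k + 1) ω
    · rw [Set.indicator_of_mem (by exact ⟨hT, h2⟩),
        split_max (fun u => S u ω i), split_max (fun u => S u ω i)]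
      ring
    · rw [Set.indicator_of_notMem (by exact fun h => h2 h.2)]
      have a1 := not_lt.1 h2
      have a2 := (θ.τ_mono k ω).trans a1
      rw [← min_assoc, ← min_assoc, min_eq_left a1, min_eq_left a2]
      simp
  · rw [if_neg hT]
    refine Finset.sum_eq_zero fun k _ => Finset.sum_eq_zero fun i _ => ?_
    change Set.indicator {ω | σ ω < T ∧ σ ω < θ.τ (k + 1) ω} (θ.ϑ k) ω i * _ = 0
    rw [Set.indicator_of_notMem (by exact fun h => hT h.1)]
    exact zero_mul _

lemma delayed_good (hS_nonneg : ∀ t ω i, 0 ≤ S t ω i) {θ : SimpleStrategy ℱ d} {x y : ℝ}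
    (hx : 0 ≤ x) (hy : 0 ≤ y) (σ : Ω → ℝ≥0)
    (hσ : IsStoppingTime ℱ (fun ω => (σ ω : WithTop ℝ≥0))) (T : ℝ≥0) {ω : Ω}
    (hle : σ ω < T → θ.wealth S x (σ ω) ω ≤ y)
    (h : Good θ S x ω) : Good (delayed θ σ hσ T) S y ω := by
  intro j hj
  match j, hj with
  | 0, _ =>
    refine ⟨fun i => le_rfl, ?_⟩
    rw [(delayed θ σ hσ T).τ_zero, wealth_zero]
    refine le_trans (le_of_eq ?_) hy
    exact Finset.sum_eq_zero fun i _ => zero_mul _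
  | k + 1, hj =>
    have hk : k < θ.n := Nat.lt_of_succ_lt_succ hj
    change (∀ i, 0 ≤ Set.indicator {ω | σ ω < T ∧ σ ω < θ.τ (k + 1) ω} (θ.ϑ k) ω i) ∧
      ∑ i, Set.indicator {ω | σ ω < T ∧ σ ω < θ.τ (k + 1) ω} (θ.ϑ k) ω i *
        S (max (θ.τ k ω) (σ ω)) ω i ≤
      (delayed θ σ hσ T).wealth S y (max (θ.τ k ω) (σ ω)) ω
    rw [delayed_wealth θ σ hσ T S x y, min_eq_left (le_max_right _ _)]
    by_cases hc : σ ω < T ∧ σ ω < θ.τ (k + 1) ω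
    · rw [Set.indicator_of_mem (by exact hc), if_pos hc.1]
      refine ⟨(h k hk).1, ?_⟩
      have := good_between h hk (le_max_left (θ.τ k ω) (σ ω))
        (max_le (θ.τ_mono k ω) hc.2.le)
      have := hle hc.1
      linarith
    · rw [Set.indicator_of_notMem (by exact hc)]
      refine ⟨fun i => le_rfl, ?_⟩
      have h0 : ∑ i, (0 : Fin d → ℝ) i * S (max (θ.τ k ω) (σ ω)) ω i = 0 :=
        Finset.sum_eq_zero fun i _ => zero_mul _
      rw [h0]
      split_ifs with hT
      · have := hle hT
        have := good_nonneg hS_nonneg hx h (max (θ.τ k ω) (σ ω))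
        linarith
      · linarith

/-- First time in `D` before `T` at which the process is below `y`, capped at `T`. -/
def firstTime (X : ℝ≥0 → Ω → ℝ) (D : Set ℝ≥0) (T : ℝ≥0) (y : ℝ) (ω : Ω) : ℝ≥0 :=
  sInf (insert T {q | q ∈ D ∧ q < T ∧ X q ω < y})

lemma firstTime_lt_iff (X : ℝ≥0 → Ω → ℝ) (D : Set ℝ≥0) (T : ℝ≥0) (y : ℝ) (ω : Ω) (t : ℝ≥0) :
    firstTime X D T y ω < t ↔ T < t ∨ ∃ q ∈ D, q < T ∧ q < t ∧ X q ω < y := by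
  unfold firstTime
  rw [csInf_lt_iff (OrderBot.bddBelow _) (Set.insert_nonempty _ _)]
  constructor
  · rintro ⟨b, hb | ⟨h1, h2, h3⟩, hbt⟩
    · left; rwa [← hb]
    · exact Or.inr ⟨b, h1, h2, hbt, h3⟩
  · rintro (h | ⟨q, h1, h2, h3, h4⟩)
    · exact ⟨T, Or.inl rfl, h⟩
    · exact ⟨q, Or.inr ⟨h1, h2, h4⟩, h3⟩

lemma firstTime_stopping (hright : RightContinuousFiltration ℱ) {X : ℝ≥0 → Ω → ℝ}
    (hX : ∀ t, Measurable[ℱ t] (X t)) {D : Set ℝ≥0} (hD : D.Countable) (T : ℝ≥0) (y : ℝ) :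
    IsStoppingTime ℱ (fun ω => (firstTime X D T y ω : WithTop ℝ≥0)) := by
  have : ℱ.IsRightContinuous := ⟨fun t => by
    rw [Filtration.rightCont_eq]; exact (hright t).symm.le⟩
  refine isStoppingTime_of_measurableSet_lt_of_isRightContinuous fun t => ?_
  have : {ω | (firstTime X D T y ω : WithTop ℝ≥0) < t} =
      {_ω | T < t} ∪ ⋃ q ∈ {q | q ∈ D ∧ q < T ∧ q < t}, (X q) ⁻¹' (Iio y) := by
    ext ω
    have h2 : ((firstTime X D T y ω : WithTop ℝ≥0) < t) ↔ firstTime X D T y ω < t :=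
      WithTop.coe_lt_coe
    simp only [Set.mem_ofPred_eq, h2, firstTime_lt_iff, Set.mem_union, Set.mem_iUnion,
      Set.mem_preimage, Set.mem_Iio, exists_prop, and_assoc]
  rw [this]
  refine MeasurableSet.union (MeasurableSet.const _) ?_
  refine MeasurableSet.biUnion (hD.mono fun q hq => hq.1) fun q hq => ?_
  exact ℱ.mono hq.2.2.le _ (hX q measurableSet_Iio)

lemma firstTime_le_val {X : ℝ≥0 → Ω → ℝ} {D : Set ℝ≥0} {T : ℝ≥0} {y : ℝ} {ω : Ω}
    (hf : ∀ t, ContinuousWithinAt (fun s => X s ω) (Set.Ici t) t)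
    (h : firstTime X D T y ω < T) : X (firstTime X D T y ω) ω ≤ y := by
  by_contra hlt
  have h1 : (fun s => X s ω) ⁻¹' (Ioi y) ∈ 𝓝[≥] (firstTime X D T y ω) :=
    hf _ (isOpen_Ioi.mem_nhds (not_le.1 hlt))
  obtain ⟨u, hu, hsub⟩ := (mem_nhdsGE_iff_exists_Ico_subset' h).1 h1
  rcases (firstTime_lt_iff X D T y ω (min u T)).1 (lt_min hu h) with h2 | ⟨q, hq, hqT, hqu, hqy⟩
  · exact absurd h2 (not_lt.2 (min_le_right _ _))
  · have hge : firstTime X D T y ω ≤ q := by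
      by_contra hn
      have hmem : q ∈ insert T {q | q ∈ D ∧ q < T ∧ X q ω < y} := Or.inr ⟨hq, hqT, hqy⟩
      exact hn (csInf_le (OrderBot.bddBelow _) hmem)
    have : y < X q ω := hsub ⟨hge, hqu.trans_le (min_le_left _ _)⟩
    exact absurd hqy (not_lt.2 this.le)

end ReviveAux

open ReviveAux in
/-- Under condition NA1_s, every wealth process `X ∈ 𝒳_s` cannot revive from bankruptcy:
a.s., `X_t = 0` for all `t ≥ ζ^X` on `{ζ^X < ∞}`. -/
theorem na1s_cannotRevive
    {Ω : Type*} {m : MeasurableSpace Ω} (P : MeasureTheory.Measure Ω)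
    [MeasureTheory.IsProbabilityMeasure P] (ℱ : MeasureTheory.Filtration ℝ≥0 m)
    (hright : RightContinuousFiltration ℱ) (hcompl : CompleteFiltration ℱ P)
    (d : ℕ) (S : ℝ≥0 → Ω → Fin d → ℝ)
    (hS_adapted : MeasureTheory.StronglyAdapted ℱ S)
    (hS_cadlag : ∀ ω, IsCadlag (fun t => S t ω))
    (hS_nonneg : ∀ t ω i, 0 ≤ S t ω i)
    (hNA1 : NA1s P ℱ S) :
    ∀ X ∈ XsAll P ℱ S, CannotRevive P X := by
  rintro X ⟨x, hx, θ, hθ, rfl⟩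
  obtain ⟨D, hDc, hD⟩ := TopologicalSpace.exists_countable_dense ℝ≥0
  have hgood : ∀ᵐ ω ∂P, Good θ S x ω := by
    have : ∀ᵐ ω ∂P, ∀ j, j < θ.n → (∀ i, 0 ≤ θ.ϑ j ω i) ∧
        ∑ i, θ.ϑ j ω i * S (θ.τ j ω) ω i ≤ θ.wealth S x (θ.τ j ω) ω := by
      rw [ae_all_iff]
      intro j
      by_cases hj : j < θ.n
      · filter_upwards [hθ j hj] with ω h _ using h
      · exact Eventually.of_forall fun ω h => absurd h hj
    exact this
  have hmeas : ∀ t, Measurable[ℱ t] (θ.wealth S x t) :=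
    fun t => measurable_wealth hS_adapted hS_cadlag θ x t
  have hrc := right_cont_wealth hS_cadlag θ x
  have main : ∀ T ∈ D, ∀ᵐ ω ∂P,
      (∀ n : ℕ, ∃ q ∈ D, q < T ∧ θ.wealth S x q ω < 1 / ((n : ℝ) + 1)) →
        θ.wealth S x T ω = 0 := by
    intro T _
    let B : Set Ω := ⋂ n : ℕ, ⋃ q ∈ {q | q ∈ D ∧ q < T},
      (θ.wealth S x q) ⁻¹' (Iio (1 / ((n : ℝ) + 1)))
    have hBmem : ∀ ω, ω ∈ B ↔
        ∀ n : ℕ, ∃ q ∈ D, q < T ∧ θ.wealth S x q ω < 1 / ((n : ℝ) + 1) := by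
      intro ω
      simp only [B, Set.mem_iInter, Set.mem_iUnion, Set.mem_preimage, Set.mem_Iio,
        Set.mem_ofPred_eq, exists_prop, and_assoc]
    have hB : MeasurableSet[ℱ T] B := by
      refine MeasurableSet.iInter fun n => ?_
      refine MeasurableSet.biUnion (hDc.mono fun q hq => hq.1) fun q hq => ?_
      exact ℱ.mono hq.2.le _ (hmeas q measurableSet_Iio)
    have hnot := hNA1 T (B.indicator (θ.wealth S x T))
    have hzero : P {ω | 0 < B.indicator (θ.wealth S x T) ω} = 0 := by
      by_contra hne
      refine hnot ⟨(hmeas T).indicator hB, ?_, pos_iff_ne_zero.2 hne, ?_⟩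
      · filter_upwards [hgood] with ω h
        exact Set.indicator_apply_nonneg fun _ => good_nonneg hS_nonneg hx h T
      · intro y hy
        have hσ := firstTime_stopping hright hmeas hDc T y
        have hle : ∀ ω, firstTime (θ.wealth S x) D T y ω < T →
            θ.wealth S x (firstTime (θ.wealth S x) D T y ω) ω ≤ y :=
          fun ω h => firstTime_le_val (hrc ω) h
        refine ⟨_, ⟨delayed θ _ hσ T, ?_, rfl⟩, ?_⟩
        · intro j hj
          filter_upwards [hgood] with ω h
          exact delayed_good hS_nonneg hx hy.le _ hσ T (hle ω) h j hj
        · filter_upwards [hgood] with ω h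
          rw [delayed_wealth θ _ hσ T S x y]
          have hT0 := good_nonneg hS_nonneg hx h T
          have hval : B.indicator (θ.wealth S x T) ω ≤ θ.wealth S x T ω :=
            Set.indicator_apply_le' (fun _ => le_rfl) (fun _ => hT0)
          split_ifs with hlt
          · rw [min_eq_left hlt.le]
            have := hle ω hlt
            linarith
          · have : ω ∉ B := by
              intro hω
              obtain ⟨n, hn⟩ := exists_nat_one_div_lt hy
              obtain ⟨q, hq, hqT, hqn⟩ := (hBmem ω).1 hω n
              exact hlt ((firstTime_lt_iff _ _ _ _ _ _).2
                (Or.inr ⟨q, hq, hqT, hqT, hqn.trans hn⟩))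
            rw [Set.indicator_of_notMem this]
            linarith
    have hae : ∀ᵐ ω ∂P, ¬ 0 < B.indicator (θ.wealth S x T) ω := by
      rw [ae_iff]; simpa using hzero
    filter_upwards [hae, hgood] with ω h1 h2 hω
    rw [Set.indicator_of_mem ((hBmem ω).2 hω)] at h1
    exact le_antisymm (not_lt.1 h1) (good_nonneg hS_nonneg hx h2 T)
  have hall := (ae_ball_iff hDc).2 main
  unfold CannotRevive
  filter_upwards [hall, hgood] with ω h1 h2 t ht
  exact path_final (hrc ω) (good_nonneg hS_nonneg hx h2) hD h1 t ht

end
end
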